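/- Let P be a combinatorially symmetric tree sign pattern with 0-diagonal of order n, and let P′ be a negation of P (same zero pattern, 0-diagonal, every edge sign reversed). Then P′ requires a unique inertia if and only if P is consistent. -/

import Mathlib

open Polynomial Matrix

def QClass {n : ℕ} (P : Matrix (Fin n) (Fin n) SignType) (B : Matrix (Fin n) (Fin n) ℝ) : Prop :=
  ∀ i j, SignType.sign (B i j) = P i j

noncomputable def charRoots {n : ℕ} (B : Matrix (Fin n) (Fin n) ℝ) : Multiset ℂ :=
  ((B.charpoly).map (algebraMap ℝ ℂ)).roots

noncomputable def inertia {n : ℕ} (B : Matrix (Fin n) (Fin n) ℝ) : ℕ × ℕ × ℕ :=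
  (((charRoots B).filter (fun z => 0 < z.re)).card,
   ((charRoots B).filter (fun z => z.re < 0)).card,
   ((charRoots B).filter (fun z => z.re = 0)).card)

def RequiresUniqueInertia {n : ℕ} (P : Matrix (Fin n) (Fin n) SignType) : Prop :=
  ∀ B₁ B₂, QClass P B₁ → QClass P B₂ → inertia B₁ = inertia B₂

/-- `P'` is a negation of `P`: same zero pattern, `0`-diagonal, every edge sign reversed. -/
def IsNegationOf {n : ℕ} (P' P : Matrix (Fin n) (Fin n) SignType) : Prop :=
  (∀ i, P' i i = 0) ∧ (∀ i j, P' i j ≠ 0 ↔ P i j ≠ 0) ∧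
    (∀ i j, i ≠ j → P i j ≠ 0 → P' i j * P' j i = -(P i j * P j i))

/-- `P` is consistent: every matrix in the qualitative class of `P` has the same number of
real eigenvalues, counted with algebraic multiplicity. -/
def Consistent {n : ℕ} (P : Matrix (Fin n) (Fin n) SignType) : Prop :=
  ∃ k : ℕ, ∀ B, QClass P B → ((charRoots B).filter (fun z => z.im = 0)).card = k

/-- On a tree, multiplicative edge weights `f` with `f u v * f v u = 1` are quotients `d v / d u`
of a nowhere-vanishing potential `d`. -/
theorem SimpleGraph.IsTree.exists_potential {V K : Type*} [Field K] {G : SimpleGraph V}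
    (hG : G.IsTree) (f : V → V → K) (hf : ∀ u v, G.Adj u v → f u v * f v u = 1) :
    ∃ d : V → K, (∀ v, d v ≠ 0) ∧ ∀ u v, G.Adj u v → d u * f u v = d v := by
  obtain ⟨r⟩ := hG.connected.nonempty
  choose p hp _ using fun v => hG.existsUnique_path r v
  have key (u v) (h : G.Adj u v) (hu : u ∈ (p v).support) :
      ((p u).darts.map fun e => f e.fst e.snd).prod * f u v =
        ((p v).darts.map fun e => f e.fst e.snd).prod := by
    rw [hG.isAcyclic.path_concat (hp u) (hp v) h hu, SimpleGraph.Walk.darts_concat]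
    simp
  refine ⟨fun v => ((p v).darts.map fun e => f e.fst e.snd).prod, fun v => ?_, fun u v h => ?_⟩
  · refine List.prod_ne_zero fun h0 => ?_
    obtain ⟨e, -, he⟩ := List.mem_map.1 h0
    exact left_ne_zero_of_mul_eq_one (hf _ _ e.adj) he
  · by_cases hu : u ∈ (p v).support
    · exact key u v h hu
    · have hv := hG.isAcyclic.mem_support_of_ne_mem_support_of_adj_of_isPath (hp u) (hp v) h hu
      simp only [← key v u h.symm hv, mul_assoc, hf v u h.symm, mul_one]

/-- The characteristic polynomial of a matrix supported on the edges of a tree depends only on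
the products of opposite entries. -/
theorem Matrix.charpoly_eq_of_isTree {V K : Type*} [Fintype V] [DecidableEq V] [Field K]
    {G : SimpleGraph V} (hG : G.IsTree) {M N : Matrix V V K}
    (hM : ∀ i j, M i j ≠ 0 ↔ G.Adj i j) (hN : ∀ i j, N i j ≠ 0 ↔ G.Adj i j)
    (h : ∀ i j, M i j * M j i = N i j * N j i) : M.charpoly = N.charpoly := by
  obtain ⟨d, hd, hdf⟩ := hG.exists_potential (fun i j => M i j / N i j) fun i j hij => by
    rw [div_mul_div_comm, h]
    exact div_self (mul_ne_zero ((hN _ _).2 hij) ((hN _ _).2 hij.symm))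
  let D : (Matrix V V K)ˣ :=
    ⟨diagonal d, diagonal d⁻¹, by simp [hd], by simp [hd]⟩
  rw [← Matrix.charpoly_units_conj D M, ← coe_units_inv]
  congr 1
  ext i j
  change (diagonal d * M * diagonal d⁻¹) i j = N i j
  rw [mul_diagonal, diagonal_mul, Pi.inv_apply]
  by_cases hij : G.Adj i j
  · rw [← hdf i j hij]
    have h1 := hd i
    have h2 := (hM i j).2 hij
    have h3 := (hN i j).2 hij
    field_simp
  · rw [not_not.1 (mt (hM i j).1 hij), not_not.1 (mt (hN i j).1 hij)]
    simp

theorem Matrix.charpoly_smul_eq_scaleRoots {V K : Type*} [Fintype V] [DecidableEq V] [Field K]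
    [Infinite K] (M : Matrix V V K) {c : K} (hc : c ≠ 0) :
    (c • M).charpoly = M.charpoly.scaleRoots c := by
  refine Polynomial.funext fun x => ?_
  obtain ⟨y, rfl⟩ : ∃ y, x = c * y := ⟨c⁻¹ * x, by field_simp⟩
  rw [scaleRoots_eval_mul, eval_charpoly, eval_charpoly, charpoly_natDegree_eq_dim, ← det_smul]
  congr 1
  ext i j
  by_cases hij : i = j <;> simp [hij, mul_sub]

theorem charRoots_eq_roots_charpoly_map {n : ℕ} (B : Matrix (Fin n) (Fin n) ℝ) :
    charRoots B = (B.map (algebraMap ℝ ℂ)).charpoly.roots := by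
  rw [charRoots, charpoly_map]

/-- If two real matrices are supported on the same tree and their products of opposite entries
differ by the factor `c ^ 2`, then their spectra differ by the factor `c`. -/
theorem charRoots_eq_map_mul {n : ℕ} {G : SimpleGraph (Fin n)} (hG : G.IsTree)
    {A B : Matrix (Fin n) (Fin n) ℝ} (hA : ∀ i j, A i j ≠ 0 ↔ G.Adj i j)
    (hB : ∀ i j, B i j ≠ 0 ↔ G.Adj i j) {c : ℂ} (hc : c ≠ 0)
    (h : ∀ i j, ((A i j * A j i : ℝ) : ℂ) = c ^ 2 * (B i j * B j i : ℝ)) :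
    charRoots A = (charRoots B).map (c * ·) := by
  rw [charRoots_eq_roots_charpoly_map, charRoots_eq_roots_charpoly_map,
    ← roots_scaleRoots _ hc.isUnit, ← charpoly_smul_eq_scaleRoots _ hc]
  congr 1
  refine charpoly_eq_of_isTree hG (fun i j => ?_) (fun i j => ?_) fun i j => ?_
  · simpa using hA i j
  · simpa [hc] using hB i j
  · have := h i j
    push_cast at this
    simp only [map_apply, Matrix.smul_apply, smul_eq_mul, Complex.coe_algebraMap]
    rw [this]
    ring

theorem card_charRoots {n : ℕ} (B : Matrix (Fin n) (Fin n) ℝ) : (charRoots B).card = n := by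
  rw [charRoots_eq_roots_charpoly_map, IsAlgClosed.card_roots_eq_natDegree,
    charpoly_natDegree_eq_dim, Fintype.card_fin]

/-- For a matrix supported on a tree, the spectrum is symmetric about the origin, so the inertia
is determined by the number of eigenvalues on the imaginary axis. -/
theorem inertia_eq_iff_of_isTree {n : ℕ} {G : SimpleGraph (Fin n)} (hG : G.IsTree)
    {A B : Matrix (Fin n) (Fin n) ℝ} (hA : ∀ i j, A i j ≠ 0 ↔ G.Adj i j)
    (hB : ∀ i j, B i j ≠ 0 ↔ G.Adj i j) :
    inertia A = inertia B ↔ (inertia A).2.2 = (inertia B).2.2 := by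
  have key (C : Matrix (Fin n) (Fin n) ℝ) (hC : ∀ i j, C i j ≠ 0 ↔ G.Adj i j) :
      (inertia C).1 = (inertia C).2.1 ∧
        (inertia C).1 + (inertia C).2.1 + (inertia C).2.2 = n := by
    constructor
    · have hs := charRoots_eq_map_mul hG hC hC (c := -1) (by simp) (by simp)
      simp only [inertia]
      conv_lhs => rw [hs, Multiset.filter_map, Multiset.card_map]
      simp
    · have hpos := Multiset.filter_add_not (fun z : ℂ => 0 < z.re) (charRoots C)
      have hneg := Multiset.filter_add_not (fun z : ℂ => z.re < 0)
        ((charRoots C).filter fun z => ¬ 0 < z.re)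
      rw [Multiset.filter_filter, Multiset.filter_filter] at hneg
      have h1 : (charRoots C).filter (fun z => z.re < 0 ∧ ¬ 0 < z.re) =
          (charRoots C).filter fun z => z.re < 0 :=
        Multiset.filter_congr fun z _ => by grind
      have h2 : (charRoots C).filter (fun z => ¬ z.re < 0 ∧ ¬ 0 < z.re) =
          (charRoots C).filter fun z => z.re = 0 :=
        Multiset.filter_congr fun z _ => by grind
      rw [← hneg, h1, h2] at hpos
      have := congrArg Multiset.card hpos
      rw [card_charRoots, Multiset.card_add, Multiset.card_add] at this
      simp only [inertia]
      omega
  have hA' := key A hA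
  have hB' := key B hB
  refine ⟨fun h => by rw [h], fun h => Prod.ext ?_ (Prod.ext ?_ h)⟩ <;> omega

theorem QClass.ne_zero_iff {n : ℕ} {P : Matrix (Fin n) (Fin n) SignType}
    {B : Matrix (Fin n) (Fin n) ℝ} (hB : QClass P B) (i j : Fin n) : B i j ≠ 0 ↔ P i j ≠ 0 := by
  rw [← hB, sign_ne_zero]

theorem exists_qClass {n : ℕ} (P : Matrix (Fin n) (Fin n) SignType) : ∃ B, QClass P B :=
  ⟨P.map fun s => (s : ℝ), fun i j => by cases h : P i j <;> simp [h]⟩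

/-- Every matrix in the class of a sign pattern has a partner of the same absolute values in the
class of its negation, and opposite entries have opposite products. -/
theorem IsNegationOf.exists_qClass {n : ℕ} {P P' : Matrix (Fin n) (Fin n) SignType}
    (hneg : IsNegationOf P' P) (hdiag : ∀ i, P i i = 0) {B : Matrix (Fin n) (Fin n) ℝ}
    (hB : QClass P B) :
    ∃ A, QClass P' A ∧ ∀ i j, A i j * A j i = -(B i j * B j i) := by
  refine ⟨fun i j => (P' i j : ℝ) * |B i j|, fun i j => ?_, fun i j => ?_⟩
  · by_cases h : P i j = 0
    · have h' : P' i j = 0 := not_not.1 (mt (hneg.2.1 i j).1 (not_not.2 h))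
      simp [h']
    · rw [sign_mul, sign_pos (abs_pos.2 ((hB.ne_zero_iff i j).2 h)), mul_one]
      cases P' i j <;> simp
  · by_cases h : P i j = 0
    · have : B i j = 0 := not_not.1 (mt (hB.ne_zero_iff i j).1 (not_not.2 h))
      simp [this]
    · have hij : i ≠ j := by rintro rfl; exact h (hdiag i)
      have hprod : (P' i j : ℝ) * P' j i = -(P i j * P j i) := by
        exact_mod_cast congrArg (SignType.cast : SignType → ℝ) (hneg.2.2 i j hij h)
      calc (P' i j : ℝ) * |B i j| * (P' j i * |B j i|)
          = (P' i j * P' j i) * (|B i j| * |B j i|) := by ring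
        _ = -((P i j * |B i j|) * (P j i * |B j i|)) := by rw [hprod]; ring
        _ = -(B i j * B j i) := by rw [← hB i j, ← hB j i, sign_mul_abs, sign_mul_abs]

theorem IsNegationOf.symm {n : ℕ} {P P' : Matrix (Fin n) (Fin n) SignType}
    (hneg : IsNegationOf P' P) (hdiag : ∀ i, P i i = 0) : IsNegationOf P P' :=
  ⟨hdiag, fun i j => (hneg.2.1 i j).symm, fun i j hij h => by
    rw [hneg.2.2 i j hij ((hneg.2.1 i j).1 h), neg_neg]⟩

/-- A combinatorially symmetric tree sign pattern with `0`-diagonal has a negation that requires a unique inertia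
if and only if the original pattern is consistent. -/
theorem tree_pattern_negation_unique_inertia_iff_consistent (n : ℕ)
    (P P' : Matrix (Fin n) (Fin n) SignType)
    (hdiag : ∀ i, P i i = 0)
    (hsym : ∀ i j, P i j ≠ 0 ↔ P j i ≠ 0)
    (htree : (SimpleGraph.fromRel (fun i j : Fin n => P i j ≠ 0)).IsTree)
    (hneg : IsNegationOf P' P) :
    RequiresUniqueInertia P' ↔ Consistent P := by
  set G := SimpleGraph.fromRel (fun i j : Fin n => P i j ≠ 0) with hGdef
  have hPG (i j) : P i j ≠ 0 ↔ G.Adj i j := by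
    rw [hGdef, SimpleGraph.fromRel_adj, ← hsym i j, or_self, iff_and_self]
    rintro h rfl
    exact h (hdiag i)
  have hadj {B} (hB : QClass P B) (i j) : B i j ≠ 0 ↔ G.Adj i j :=
    (hB.ne_zero_iff i j).trans (hPG i j)
  have hadj' {A} (hA : QClass P' A) (i j) : A i j ≠ 0 ↔ G.Adj i j :=
    ((hA.ne_zero_iff i j).trans (hneg.2.1 i j)).trans (hPG i j)
  have hcount {A B} (hA : QClass P' A) (hB : QClass P B)
      (h : ∀ i j, A i j * A j i = -(B i j * B j i)) :
      (inertia A).2.2 = ((charRoots B).filter (fun z => z.im = 0)).card := by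
    have hs := charRoots_eq_map_mul htree (hadj' hA) (hadj hB) Complex.I_ne_zero fun i j => by
      rw [h i j, Complex.I_sq, Complex.ofReal_neg, neg_one_mul]
    simp only [inertia]
    rw [hs, Multiset.filter_map, Multiset.card_map]
    simp
  constructor
  · intro hU
    obtain ⟨A₀, hA₀⟩ := exists_qClass P'
    refine ⟨(inertia A₀).2.2, fun B hB => ?_⟩
    obtain ⟨A, hA, hAB⟩ := hneg.exists_qClass hdiag hB
    rw [← hcount hA hB hAB, hU A A₀ hA hA₀]
  · rintro ⟨k, hk⟩ A₁ A₂ h₁ h₂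
    have hzero {A} (hA : QClass P' A) : (inertia A).2.2 = k := by
      obtain ⟨B, hB, hBA⟩ := (hneg.symm hdiag).exists_qClass hneg.1 hA
      rw [hcount hA hB fun i j => by rw [hBA, neg_neg], hk B hB]
    rw [inertia_eq_iff_of_isTree htree (hadj' h₁) (hadj' h₂), hzero h₁, hzero h₂]
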